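/- arXiv:2202.13573 — 2 statements merged into one kernel-verified Lean document; each statement's English description precedes it below -/
import Mathlib

section
/- Every nonnegative integer is represented by the ternary quadratic form x² + y² + 2z² over the integers except exactly the integers of the form 2^(2s+1)·(8t+7) for nonnegative integers s and t. -/
/-- The integral ternary quadratic form
`a x² + b y² + c z² + 2d yz + 2e xz + 2f xy`. -/
def ternaryForm (a b c d e f x y z : ℤ) : ℤ :=
  a * x ^ 2 + b * y ^ 2 + c * z ^ 2 + 2 * d * y * z + 2 * e * x * z + 2 * f * x * y

theorem Int.exists_four_mul_add_mul_sq_le (f : ℤ) {a : ℤ} (ha : 0 < a) :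
    ∃ k : ℤ, 4 * (f + a * k) ^ 2 ≤ a ^ 2 := by
  have h1 := Int.emod_nonneg f ha.ne'
  have h2 := Int.emod_lt_of_pos f ha
  have h3 := Int.emod_add_mul_ediv f a
  rcases le_total (2 * (f % a)) a with h | h
  · refine ⟨-(f / a), ?_⟩
    rw [show f + a * -(f / a) = f % a by linarith]
    nlinarith
  · refine ⟨-(f / a) - 1, ?_⟩
    rw [show f + a * (-(f / a) - 1) = f % a - a by linarith]
    nlinarith

/-- Every value of a positive definite integral ternary form of determinant one
is a sum of three squares (Gauss). -/
theorem ternaryForm_eq_sum_three_squares (a b c d e f : ℤ) (ha : 0 < a)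
    (hA : 0 < a * b - f ^ 2)
    (hdet : a * b * c + 2 * d * e * f - a * d ^ 2 - b * e ^ 2 - c * f ^ 2 = 1) (x y z : ℤ) :
    ∃ u v w : ℤ, ternaryForm a b c d e f x y z = u ^ 2 + v ^ 2 + w ^ 2 := by
  obtain ⟨k, hk⟩ := Int.exists_four_mul_add_mul_sq_le f ha
  obtain ⟨l, hl⟩ := Int.exists_four_mul_add_mul_sq_le (a * d - e * f) hA
  by_cases hb : b + 2 * f * k + a * k ^ 2 < a
  · have hA' : (b + 2 * f * k + a * k ^ 2) * a - (f + a * k) ^ 2 = a * b - f ^ 2 := by ring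
    have hb0 : 0 < b + 2 * f * k + a * k ^ 2 := by
      by_contra! h
      nlinarith [sq_nonneg (f + a * k)]
    obtain ⟨u, v, w, h⟩ := ternaryForm_eq_sum_three_squares
      (b + 2 * f * k + a * k ^ 2) a c e (d + e * k) (f + a * k) hb0 (hA' ▸ hA)
      (by rw [← hdet]; ring) y (x - k * y) z
    exact ⟨u, v, w, by rw [← h]; unfold ternaryForm; ring⟩
  by_cases hc : a * (c + 2 * d * l + b * l ^ 2) - (e + f * l) ^ 2 < a * b - f ^ 2
  · have hdet' : (a * b - f ^ 2) * (a * (c + 2 * d * l + b * l ^ 2) - (e + f * l) ^ 2)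
        = a + ((a * d - e * f) + (a * b - f ^ 2) * l) ^ 2 := by
      linear_combination a * hdet
    have hc0 : 0 < a * (c + 2 * d * l + b * l ^ 2) - (e + f * l) ^ 2 := by
      by_contra! h
      nlinarith [sq_nonneg ((a * d - e * f) + (a * b - f ^ 2) * l)]
    obtain ⟨u, v, w, h⟩ := ternaryForm_eq_sum_three_squares
      a (c + 2 * d * l + b * l ^ 2) b (d + b * l) f (e + f * l) ha hc0
      (by rw [← hdet]; ring) x z (y - l * z)
    exact ⟨u, v, w, by rw [← h]; unfold ternaryForm; ring⟩
  push Not at hb hc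
  have h1 : 3 * a ^ 2 ≤ 4 * (a * b - f ^ 2) := by
    nlinarith [mul_le_mul_of_nonneg_left hb ha.le]
  have h2 : 3 * (a * b - f ^ 2) ^ 2 ≤ 4 * a := by
    have := mul_le_mul_of_nonneg_left hc hA.le
    have hdet' : (a * b - f ^ 2) * (a * (c + 2 * d * l + b * l ^ 2) - (e + f * l) ^ 2)
        = a + ((a * d - e * f) + (a * b - f ^ 2) * l) ^ 2 := by
      linear_combination a * hdet
    nlinarith
  have h3 : a = 1 ∧ a * b - f ^ 2 = 1 := by
    generalize a * b - f ^ 2 = A at *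
    rcases le_or_gt a A with h | h
    · have : A ≤ 1 := by nlinarith
      omega
    · have : a ≤ 1 := by nlinarith
      omega
  obtain ⟨rfl, h4⟩ := h3
  obtain rfl : b = 1 + f ^ 2 := by linarith
  refine ⟨x + f * y + e * z, y + (d - e * f) * z, z, ?_⟩
  unfold ternaryForm
  linear_combination z ^ 2 * hdet
termination_by (a.toNat, (a * b - f ^ 2).toNat)
decreasing_by
  · exact Prod.Lex.left _ _ (by omega)
  · exact Prod.Lex.right _ (by omega)

theorem eq_sum_three_squares_of_dvd {n b m x : ℤ} (hb : 0 < b) (hm : 0 < m)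
    (h : b * n = m + 1) (hx : m ∣ x ^ 2 + b) :
    ∃ u v w : ℤ, n = u ^ 2 + v ^ 2 + w ^ 2 := by
  obtain ⟨a, ha⟩ := hx
  have ha0 : 0 < a := by
    by_contra! h
    nlinarith [sq_nonneg x]
  obtain ⟨u, v, w, h⟩ := ternaryForm_eq_sum_three_squares a m n 0 1 x ha0 (by linarith)
    (by linear_combination h - n * ha) 0 0 1
  exact ⟨u, v, w, by rw [← h]; unfold ternaryForm; ring⟩

open NumberTheorySymbols in
theorem jacobiSym_neg_eq_of_mod_four {b p : ℕ} (hb : Odd b) (hp : Odd p)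
    (h : p % 4 = 1 ∨ b % 4 = 3) : J(-b | p) = J(p | b) := by
  rw [jacobiSym.neg _ hp]
  rcases Nat.odd_mod_four_iff.mp (Nat.odd_iff.mp hp) with hp4 | hp4
  · rw [ZMod.χ₄_nat_one_mod_four hp4, one_mul,
      jacobiSym.quadratic_reciprocity_one_mod_four' hb hp4]
  · rw [ZMod.χ₄_nat_three_mod_four hp4,
      jacobiSym.quadratic_reciprocity_three_mod_four (h.resolve_left (by omega)) hp4]
    ring

open NumberTheorySymbols in
/-- If the Jacobi symbol `J(p | b)` equals one, then `-b` is a square modulo `p`. -/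
theorem exists_dvd_sq_add_of_jacobiSym_eq_one {b p : ℕ} [Fact p.Prime] (hb : Odd b) (hp : Odd p)
    (h : p % 4 = 1 ∨ b % 4 = 3) (hJ : J(p | b) = 1) : ∃ x : ℤ, (p : ℤ) ∣ x ^ 2 + b := by
  rw [← jacobiSym_neg_eq_of_mod_four hb hp h] at hJ
  obtain ⟨r, hr⟩ := ZMod.isSquare_of_jacobiSym_eq_one hJ
  obtain ⟨x, rfl⟩ := ZMod.intCast_surjective r
  refine ⟨x, (ZMod.intCast_zmod_eq_zero_iff_dvd _ p).mp ?_⟩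
  push_cast at hr ⊢
  linear_combination -hr

open NumberTheorySymbols in
theorem jacobiSym_eq_one_of_mul_eq_one_sub {b n : ℕ} {c p : ℤ}
    (h : (b : ℤ) * n = 1 - c * p) (hc : J(c | b) = 1) : J(p | b) = 1 := by
  have hmul : J(c * p | b) = 1 := by
    refine (jacobiSym.mod_left' ?_).trans (jacobiSym.one_left b)
    rw [show c * p = 1 - b * n by linarith]
    simp
  rwa [jacobiSym.mul_left, hc, one_mul] at hmul

theorem Nat.exists_prime_eq_add_mul {a q : ℕ} (hq : q ≠ 0) (h : a.Coprime q) :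
    ∃ p v : ℕ, p.Prime ∧ p = a + q * v := by
  obtain ⟨p, hp, hprime, hmod⟩ := Nat.forall_exists_prime_gt_and_modEq a hq h
  obtain ⟨v, hv⟩ := (Nat.modEq_iff_dvd' hp.le).mp hmod.symm
  exact ⟨p, v, hprime, by omega⟩

theorem sum_three_squares_of_mod_four_eq_two {n : ℕ} (hn : n % 4 = 2) :
    ∃ u v w : ℤ, (n : ℤ) = u ^ 2 + v ^ 2 + w ^ 2 := by
  have hcop : (n - 1).Coprime (4 * n) := by
    refine Nat.Coprime.mul_right ?_ ?_
    · exact Nat.Coprime.pow_right 2 (Nat.coprime_two_right.mpr (Nat.odd_iff.mpr (by omega)))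
    · exact (Nat.coprime_self_sub_left (by omega)).mpr (Nat.coprime_one_left n)
  obtain ⟨p, v, hp, hpv⟩ := Nat.exists_prime_eq_add_mul (by omega) hcop
  have : Fact p.Prime := ⟨hp⟩
  have hmul : 4 * n * v = 4 * (n * v) := by ring
  have hp4 : p % 4 = 1 := by omega
  have hbn : (4 * v + 1) * n = p + 1 := by
    rw [hpv, show (4 * v + 1) * n = 4 * n * v + n by ring]
    omega
  have hb : Odd (4 * v + 1) := Nat.odd_iff.mpr (by omega)
  zify at hbn
  obtain ⟨x, hx⟩ := exists_dvd_sq_add_of_jacobiSym_eq_one (p := p) hb (Nat.odd_iff.mpr (by omega))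
    (.inl hp4) (jacobiSym_eq_one_of_mul_eq_one_sub (c := -1) (n := n)
      (by push_cast; linarith)
      (by rw [jacobiSym.at_neg_one hb, ZMod.χ₄_nat_one_mod_four (by omega)]))
  push_cast at hx
  exact eq_sum_three_squares_of_dvd (by positivity) (by exact_mod_cast hp.pos) hbn hx

theorem sum_three_squares_of_odd {n : ℕ} (hn : n % 2 = 1) (hn7 : n % 8 ≠ 7) :
    ∃ u v w : ℤ, (n : ℤ) = u ^ 2 + v ^ 2 + w ^ 2 := by
  obtain ⟨c, a, hc, hca, ha⟩ : ∃ c a : ℕ, (c = 1 ∧ n % 8 = 3 ∨ c = 3 ∧ n % 4 = 1) ∧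
      c * n = 2 * a + 1 ∧ a % 2 = 1 := by
    by_cases h : n % 8 = 3
    · exact ⟨1, (n - 1) / 2, by omega, by omega, by omega⟩
    · exact ⟨3, (3 * n - 1) / 2, by omega, by omega, by omega⟩
  have hcop : a.Coprime (4 * n) := by
    refine Nat.Coprime.mul_right ?_ ?_
    · exact Nat.Coprime.pow_right 2 (Nat.coprime_two_right.mpr (Nat.odd_iff.mpr ha))
    · rw [← Nat.isCoprime_iff_coprime]
      exact ⟨-2, c, by zify at hca; linarith⟩
  obtain ⟨p, v, hp, hpv⟩ := Nat.exists_prime_eq_add_mul (by omega) hcop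
  have : Fact p.Prime := ⟨hp⟩
  have hmul : 4 * n * v = 4 * (n * v) := by ring
  have hp2 : p % 2 = 1 := by omega
  have hbn : (8 * v + c) * n = 2 * p + 1 := by
    rw [hpv, show (8 * v + c) * n = 2 * (4 * n * v) + c * n by ring]
    omega
  have hb : Odd (8 * v + c) := Nat.odd_iff.mpr (by omega)
  have hb8 : (8 * v + c) % 8 = 1 ∨ (8 * v + c) % 8 = 3 := by omega
  have hp4 : p % 4 = 1 ∨ (8 * v + c) % 4 = 3 := by
    rcases hc with ⟨rfl, h⟩ | ⟨rfl, h⟩ <;> omega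
  zify at hbn
  have hJ : jacobiSym (-2) (8 * v + c) = 1 := by
    rw [jacobiSym.at_neg_two hb, ZMod.χ₈'_nat_eq_if_mod_eight]
    grind
  obtain ⟨x, hx⟩ := exists_dvd_sq_add_of_jacobiSym_eq_one (p := p) hb (Nat.odd_iff.mpr hp2)
    hp4 (jacobiSym_eq_one_of_mul_eq_one_sub (c := -2) (n := n)
      (by push_cast; linarith) hJ)
  push_cast at hx
  obtain ⟨y, hy, hyp⟩ : ∃ y : ℤ, y % 2 = 1 ∧ (p : ℤ) ∣ y ^ 2 + (8 * v + c) := by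
    rcases Int.emod_two_eq_zero_or_one x with h | h
    · refine ⟨x + p, by omega, ?_⟩
      rw [show (x + p) ^ 2 + (8 * v + c : ℤ) = x ^ 2 + (8 * v + c) + p * (2 * x + p) by ring]
      exact dvd_add hx (dvd_mul_right _ _)
    · exact ⟨x, h, hx⟩
  have h2 : (2 : ℤ) ∣ y ^ 2 + (8 * v + c) := by
    have : y ^ 2 % 2 = 1 := Int.odd_iff.mp ((Int.odd_iff.mpr hy).pow)
    omega
  have hcop2 : IsCoprime (2 : ℤ) p := by
    have : Nat.Coprime 2 p := Nat.coprime_two_left.mpr (Nat.odd_iff.mpr hp2)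
    exact_mod_cast Nat.isCoprime_iff_coprime.mpr this
  exact eq_sum_three_squares_of_dvd (by omega) (by have := hp.pos; omega) hbn
    (hcop2.mul_dvd h2 hyp)

theorem exists_sq_add_sq_add_two_mul_sq_of_two_mul {n u v w : ℤ}
    (h : 2 * n = u ^ 2 + v ^ 2 + w ^ 2) : ∃ x y z : ℤ, x ^ 2 + y ^ 2 + 2 * z ^ 2 = n := by
  have key (r s t : ℤ) (hst : 2 * n = r ^ 2 + s ^ 2 + (2 * t) ^ 2) :
      ∃ x y z : ℤ, x ^ 2 + y ^ 2 + 2 * z ^ 2 = n := by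
    have hpar : Even (r + s) := by
      have : Even (r ^ 2 + s ^ 2) := ⟨n - 2 * t ^ 2, by linarith⟩
      rw [Int.even_add] at this ⊢
      simpa [Int.even_pow'] using this
    obtain ⟨q, hq⟩ := hpar
    obtain rfl : r = 2 * q - s := by linarith
    exact ⟨q, q - s, t, by linarith⟩
  rcases Int.even_or_odd' w with ⟨t, rfl | rfl⟩
  · exact key u v t h
  rcases Int.even_or_odd' v with ⟨t', rfl | rfl⟩
  · exact key u (2 * t + 1) t' (by linarith)
  rcases Int.even_or_odd' u with ⟨t'', rfl | rfl⟩
  · exact key (2 * t' + 1) (2 * t + 1) t'' (by linarith)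
  · ring_nf at h
    omega

theorem exists_sq_add_sq_add_two_mul_sq (n : ℕ)
    (hn : ¬ ∃ s t : ℕ, n = 2 ^ (2 * s + 1) * (8 * t + 7)) :
    ∃ x y z : ℤ, x ^ 2 + y ^ 2 + 2 * z ^ 2 = (n : ℤ) := by
  induction n using Nat.strong_induction_on with
  | _ n ih =>
    rcases Nat.eq_zero_or_pos n with rfl | hpos
    · exact ⟨0, 0, 0, by simp⟩
    by_cases h4 : 4 ∣ n
    · obtain ⟨m, rfl⟩ := h4
      obtain ⟨x, y, z, h⟩ := ih m (by omega) fun ⟨s, t, hst⟩ =>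
        hn ⟨s + 1, t, by rw [hst]; ring⟩
      exact ⟨2 * x, 2 * y, 2 * z, by push_cast; linarith⟩
    rcases Nat.even_or_odd' n with ⟨k, rfl | rfl⟩
    · obtain ⟨u, v, w, h⟩ := sum_three_squares_of_odd (n := k) (by omega) fun h7 =>
        hn ⟨0, k / 8, by omega⟩
      exact ⟨u + v, u - v, w, by push_cast; rw [h]; ring⟩
    · obtain ⟨u, v, w, h⟩ := sum_three_squares_of_mod_four_eq_two
        (n := 2 * (2 * k + 1)) (by omega)
      exact exists_sq_add_sq_add_two_mul_sq_of_two_mul (by exact_mod_cast h)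

theorem Int.sq_emod_sixteen (x : ℤ) :
    x ^ 2 % 16 = 0 ∨ x ^ 2 % 16 = 1 ∨ x ^ 2 % 16 = 4 ∨ x ^ 2 % 16 = 9 := by
  have h1 := Int.emod_nonneg x (show (16 : ℤ) ≠ 0 by decide)
  have h2 := Int.emod_lt_of_pos x (show (0 : ℤ) < 16 by decide)
  rw [sq, Int.mul_emod]
  interval_cases x % 16 <;> decide

theorem sq_add_sq_add_two_mul_sq_ne (s t : ℕ) (x y z : ℤ) :
    x ^ 2 + y ^ 2 + 2 * z ^ 2 ≠ 2 ^ (2 * s + 1) * (8 * t + 7) := by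
  induction s generalizing x y z with
  | zero =>
    have hx := Int.sq_emod_sixteen x
    have hy := Int.sq_emod_sixteen y
    have hz := Int.sq_emod_sixteen z
    omega
  | succ s ih =>
    intro h
    rw [show (2 : ℤ) ^ (2 * (s + 1) + 1) * (8 * t + 7) = 8 * (2 ^ (2 * s) * (8 * t + 7)) by ring]
      at h
    have hx := Int.sq_emod_sixteen x
    have hy := Int.sq_emod_sixteen y
    have hz := Int.sq_emod_sixteen z
    have even_of_sq {w : ℤ} (hw : w ^ 2 % 2 = 0) : ∃ r, w = 2 * r :=
      (even_iff_two_dvd.mp ((Int.even_pow' two_ne_zero).mp (Int.even_iff.mpr hw)))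
    obtain ⟨x, rfl⟩ := even_of_sq (w := x) (by omega)
    obtain ⟨y, rfl⟩ := even_of_sq (w := y) (by omega)
    obtain ⟨z, rfl⟩ := even_of_sq (w := z) (by omega)
    exact ih x y z (by rw [pow_succ _ (2 * s)]; linarith)

theorem stmt_2 (n : ℕ) :
    (∃ x y z : ℤ, x ^ 2 + y ^ 2 + 2 * z ^ 2 = (n : ℤ)) ↔
      ¬ ∃ s t : ℕ, n = 2 ^ (2 * s + 1) * (8 * t + 7) := by
  refine ⟨?_, exists_sq_add_sq_add_two_mul_sq n⟩
  rintro ⟨x, y, z, h⟩ ⟨s, t, rfl⟩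
  exact sq_add_sq_add_two_mul_sq_ne s t x y z (by exact_mod_cast h)
end

section
/- The diagonal quaternary quadratic form x² + y² + z² + 6w² primitively represents every positive integer except exactly 4. -/
/-- Rounding to the nearest multiple. -/
theorem exists_two_mul_abs_add_mul_le {a : ℤ} (ha : 0 < a) (t : ℤ) :
    ∃ k : ℤ, |2 * (t + k * a)| ≤ a := by
  refine ⟨-((2 * t + a) / (2 * a)), ?_⟩
  have h1 := Int.emod_add_mul_ediv (2 * t + a) (2 * a)
  have h2 := Int.emod_nonneg (2 * t + a) (by omega : 2 * a ≠ 0)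
  have h3 := Int.emod_lt_of_pos (2 * t + a) (by omega : 0 < 2 * a)
  rw [abs_le]
  constructor <;> linarith

theorem exists_binary_reduction {p : ℤ} (hp : 0 < p) (q r : ℤ) (hD : 0 < p * r - q ^ 2) :
    ∃ α β γ δ : ℤ, α * δ - β * γ = 1 ∧
      0 < p * α ^ 2 + 2 * q * α * γ + r * γ ^ 2 ∧
      3 * (p * α ^ 2 + 2 * q * α * γ + r * γ ^ 2) ^ 2 ≤ 4 * (p * r - q ^ 2) := by
  induction hN : p.toNat using Nat.strong_induction_on generalizing p q r with
  | _ N ih =>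
    by_cases hred : 3 * p ^ 2 ≤ 4 * (p * r - q ^ 2)
    · exact ⟨1, 0, 0, 1, by simpa using ⟨hp, hred⟩⟩
    · obtain ⟨k, hk⟩ := exists_two_mul_abs_add_mul_le hp q
      set p₁ := p * k ^ 2 + 2 * q * k + r with hp₁
      have hdisc : p₁ * p - (-(q + k * p)) ^ 2 = p * r - q ^ 2 := by rw [hp₁]; ring
      have hsq : 4 * (q + k * p) ^ 2 ≤ p ^ 2 := by
        have := sq_le_sq' (neg_le_of_abs_le hk) (le_of_abs_le hk)
        linarith
      have hpos : 0 < p₁ := by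
        refine pos_of_mul_pos_left (b := p) ?_ hp.le
        nlinarith [sq_nonneg (q + k * p)]
      have hlt : p₁ < p := by
        refine lt_of_mul_lt_mul_right (a := p) ?_ hp.le
        nlinarith
      obtain ⟨α, β, γ, δ, hdet, h0, h1⟩ :=
        ih p₁.toNat (by omega) hpos (-(q + k * p)) p (by rw [hdisc]; exact hD) rfl
      have hval : p * (k * α - γ) ^ 2 + 2 * q * (k * α - γ) * α + r * α ^ 2 =
          p₁ * α ^ 2 + 2 * (-(q + k * p)) * α * γ + p * γ ^ 2 := by rw [hp₁]; ring
      refine ⟨k * α - γ, k * β - δ, α, β, by linarith, ?_, ?_⟩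
      · rw [hval]; exact h0
      · rw [hval, ← hdisc]; exact h1

open Matrix in
theorem exists_gram_of_congr {A B U V : Matrix (Fin 3) (Fin 3) ℤ} (hUV : U * V = 1)
    (hB : Uᵀ * A * U = B) (h : ∃ M, B = Mᵀ * M) : ∃ M, A = Mᵀ * M := by
  obtain ⟨M, hM⟩ := h
  refine ⟨M * V, ?_⟩
  have hVU : Vᵀ * Uᵀ = 1 := by rw [← transpose_mul, hUV, transpose_one]
  calc A = (Vᵀ * Uᵀ) * A * (U * V) := by rw [hVU, hUV]; simp
    _ = Vᵀ * (Uᵀ * A * U) * V := by simp only [Matrix.mul_assoc]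
    _ = (M * V)ᵀ * (M * V) := by rw [hB, hM, transpose_mul]; simp only [Matrix.mul_assoc]

open Matrix in
/-- One reduction step: a change of basis makes the leading binary minor and the coefficient `t`
small while keeping `a`. -/
theorem exists_ternary_reduction {a b c r s t : ℤ} (ha : 0 < a) (hab : 0 < a * b - t ^ 2)
    (hdet : a * b * c + 2 * r * s * t - a * r ^ 2 - b * s ^ 2 - c * t ^ 2 = 1) :
    ∃ b' c' r' s' t' : ℤ, 0 < a * b' - t' ^ 2 ∧ 3 * (a * b' - t' ^ 2) ^ 2 ≤ 4 * a ∧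
      4 * t' ^ 2 ≤ a ^ 2 ∧
      a * b' * c' + 2 * r' * s' * t' - a * r' ^ 2 - b' * s' ^ 2 - c' * t' ^ 2 = 1 ∧
      ∃ U V : Matrix (Fin 3) (Fin 3) ℤ, U * V = 1 ∧
        Uᵀ * !![a, t, s; t, b, r; s, r, c] * U = !![a, t', s'; t', b', r'; s', r', c'] := by
  have hD : (a * b - t ^ 2) * (a * c - s ^ 2) - (a * r - s * t) ^ 2 = a := by
    linear_combination a * hdet
  obtain ⟨α, β, γ, δ, hU, hp, hle⟩ :=
    exists_binary_reduction hab (a * r - s * t) (a * c - s ^ 2) (by rw [hD]; exact ha)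
  rw [hD] at hle
  obtain ⟨k, hk⟩ := exists_two_mul_abs_add_mul_le ha (α * t + γ * s)
  obtain ⟨b', hb'⟩ : ∃ b', b' =
    a * k ^ 2 + 2 * k * (α * t + γ * s) + (b * α ^ 2 + 2 * r * α * γ + c * γ ^ 2) := ⟨_, rfl⟩
  obtain ⟨t', ht'⟩ : ∃ t', t' = α * t + γ * s + k * a := ⟨_, rfl⟩
  obtain ⟨s', hs'⟩ : ∃ s', s' = β * t + δ * s := ⟨_, rfl⟩
  obtain ⟨r', hr'⟩ : ∃ r', r' =
    k * s' + (b * α * β + r * (α * δ + β * γ) + c * γ * δ) := ⟨_, rfl⟩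
  obtain ⟨c', hc'⟩ : ∃ c', c' = b * β ^ 2 + 2 * r * β * δ + c * δ ^ 2 := ⟨_, rfl⟩
  have hminor : (a * b - t ^ 2) * α ^ 2 + 2 * (a * r - s * t) * α * γ
      + (a * c - s ^ 2) * γ ^ 2 = a * b' - t' ^ 2 := by
    rw [hb', ht']; ring
  rw [hminor] at hp hle
  rw [← ht'] at hk
  have hdet' : a * b' * c' + 2 * r' * s' * t' - a * r' ^ 2 - b' * s' ^ 2 - c' * t' ^ 2 = 1 := by
    have : a * b' * c' + 2 * r' * s' * t' - a * r' ^ 2 - b' * s' ^ 2 - c' * t' ^ 2 =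
        (α * δ - β * γ) ^ 2 *
          (a * b * c + 2 * r * s * t - a * r ^ 2 - b * s ^ 2 - c * t ^ 2) := by
      rw [hb', hr', hc', ht', hs']; ring
    rw [this, hU, hdet]; norm_num
  have hsq : 4 * t' ^ 2 ≤ a ^ 2 := by
    have := sq_le_sq' (neg_le_of_abs_le hk) (le_of_abs_le hk)
    linarith
  refine ⟨b', c', r', s', t', hp, hle, hsq, hdet', !![1, k, 0; 0, α, β; 0, γ, δ],
    !![1, -k * δ, k * β; 0, δ, -β; 0, -γ, α], ?_, ?_⟩
  · ext i j
    fin_cases i <;> fin_cases j <;> simp [Matrix.mul_apply, Fin.sum_univ_three] <;>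
      linarith
  · ext i j
    fin_cases i <;> fin_cases j <;>
      simp [Matrix.mul_apply, Fin.sum_univ_three, hb', hr', hc', ht', hs'] <;> ring

open Matrix in
/-- A positive definite integral ternary form of determinant one is a sum of three squares of
integral linear forms. -/
theorem exists_gram_of_det_eq_one {a b c r s t : ℤ} (ha : 0 < a) (hab : 0 < a * b - t ^ 2)
    (hdet : a * b * c + 2 * r * s * t - a * r ^ 2 - b * s ^ 2 - c * t ^ 2 = 1) :
    ∃ M : Matrix (Fin 3) (Fin 3) ℤ, !![a, t, s; t, b, r; s, r, c] = Mᵀ * M := by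
  induction hN : a.toNat using Nat.strong_induction_on generalizing a b c r s t with
  | _ N ih =>
    obtain ⟨b', c', r', s', t', hp, hle, hsq, hdet', U, V, hUV, hB⟩ :=
      exists_ternary_reduction ha hab hdet
    refine exists_gram_of_congr hUV hB ?_
    by_cases hlt : b' < a
    · have hb0 : 0 < b' := pos_of_mul_pos_right (a := a) (by nlinarith [sq_nonneg t']) ha.le
      refine exists_gram_of_congr (U := !![0, 1, 0; 1, 0, 0; 0, 0, 1])
        (V := !![0, 1, 0; 1, 0, 0; 0, 0, 1])
        (B := !![b', t', r'; t', a, s'; r', s', c']) ?_ ?_ ?_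
      · ext i j
        fin_cases i <;> fin_cases j <;> simp [Matrix.mul_apply, Fin.sum_univ_three]
      · ext i j
        fin_cases i <;> fin_cases j <;> simp [Matrix.mul_apply, Fin.sum_univ_three]
      · exact ih b'.toNat (by omega) hb0 (by linarith) (by linarith) rfl
    · have h3 : 3 * a ^ 2 ≤ 4 * (a * b' - t' ^ 2) := by nlinarith
      have ha1 : a = 1 := by
        by_contra hne
        have h2 : 2 ≤ a := by omega
        have h4 : (3 * a ^ 2) ^ 2 ≤ (4 * (a * b' - t' ^ 2)) ^ 2 :=
          pow_le_pow_left₀ (by positivity) h3 2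
        have h5 : 27 * a ^ 4 ≤ 64 * a := by nlinarith
        have h6 : 8 * a ≤ a ^ 3 * a :=
          mul_le_mul_of_nonneg_right (pow_le_pow_left₀ (by norm_num) h2 3) ha.le
        nlinarith
      subst ha1
      have hp1 : 1 * b' - t' ^ 2 = 1 := by nlinarith
      have hb1 : b' = 1 + t' ^ 2 := by linarith
      subst hb1
      have hc1 : c' = s' ^ 2 + (r' - s' * t') ^ 2 + 1 := by linear_combination hdet'
      refine ⟨!![1, t', s'; 0, 1, r' - s' * t'; 0, 0, 1], ?_⟩
      ext i j
      fin_cases i <;> fin_cases j <;>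
        simp [Matrix.mul_apply, Fin.sum_univ_three, hc1] <;> ring

theorem exists_rep_of_dvd {n d : ℕ} {q : ℤ} (hdn : 1 < d * n) (h : (d * n - 1 : ℤ) ∣ q ^ 2 + d) :
    ∃ x y z : ℤ, Int.gcd x (Int.gcd y z) = 1 ∧ x ^ 2 + y ^ 2 + z ^ 2 = n := by
  obtain ⟨m, hm⟩ := h
  have hdn' : (1 : ℤ) < d * n := by exact_mod_cast hdn
  have hd : (0 : ℤ) < d := by
    rcases Nat.eq_zero_or_pos d with rfl | h
    · simp at hdn
    · exact_mod_cast h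
  have hm0 : 0 < m := pos_of_mul_pos_right (a := (d * n - 1 : ℤ)) (by rw [← hm]; positivity)
    (by linarith)
  obtain ⟨M, hM⟩ := exists_gram_of_det_eq_one (a := m) (b := d * n - 1) (c := n) (r := 0) (s := 1)
    (t := q) hm0 (by linarith) (by linear_combination -(n : ℤ) * hm)
  have h02 := congrFun (congrFun hM 0) 2
  have h22 := congrFun (congrFun hM 2) 2
  simp only [Matrix.of_apply, Matrix.cons_val, Matrix.mul_apply, Matrix.transpose_apply,
    Fin.sum_univ_three] at h02 h22
  refine ⟨M 0 2, M 1 2, M 2 2, ?_, by linarith⟩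
  have hg : ((Int.gcd (M 0 2) (Int.gcd (M 1 2) (M 2 2)) : ℕ) : ℤ) ∣ 1 := by
    have h1 := Int.gcd_dvd_right (M 0 2) (Int.gcd (M 1 2) (M 2 2))
    rw [h02]
    exact dvd_add (dvd_add ((Int.gcd_dvd_left _ _).mul_left _)
      ((h1.trans (Int.gcd_dvd_left _ _)).mul_left _))
      ((h1.trans (Int.gcd_dvd_right _ _)).mul_left _)
  exact Nat.dvd_one.mp (by exact_mod_cast hg)

open scoped NumberTheorySymbols

theorem exists_dvd_sq_add_of_jacobiSym {p : ℕ} (hp : p.Prime) {d : ℤ} (h : J(-d | p) = 1) :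
    ∃ x : ℤ, (p : ℤ) ∣ x ^ 2 + d := by
  have := Fact.mk hp
  obtain ⟨y, hy⟩ := ZMod.isSquare_of_jacobiSym_eq_one h
  obtain ⟨x, rfl⟩ := ZMod.intCast_surjective y
  refine ⟨x, (ZMod.intCast_zmod_eq_zero_iff_dvd _ _).mp ?_⟩
  push_cast at hy ⊢
  linear_combination -hy

theorem jacobiSym_neg_of_add_one_eq {p d n : ℕ} (h : p + 1 = d * n) (hp : p % 4 = 1)
    (hd : d % 4 = 1) : J(-d | p) = 1 := by
  have hdo : Odd d := Nat.odd_iff.mpr (by omega)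
  have hpo : Odd p := Nat.odd_iff.mpr (by omega)
  rw [jacobiSym.neg _ hpo, ZMod.χ₄_nat_one_mod_four hp, one_mul,
    jacobiSym.quadratic_reciprocity_one_mod_four hd hpo, ← ZMod.χ₄_nat_one_mod_four hd,
    ← jacobiSym.at_neg_one hdo]
  refine jacobiSym.mod_left' (Int.modEq_iff_dvd.mpr ⟨-n, ?_⟩)
  have h' : (p : ℤ) + 1 = d * n := by exact_mod_cast h
  linarith

theorem jacobiSym_neg_of_two_mul_add_one_eq {p d n : ℕ} (h : 2 * p + 1 = d * n) (hp : p % 2 = 1)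
    (hd : d % 8 = 3 ∨ d % 8 = 1 ∧ p % 4 = 1) : J(-d | p) = 1 := by
  have hdo : Odd d := Nat.odd_iff.mpr (by omega)
  have hpo : Odd p := Nat.odd_iff.mpr hp
  have hpd : J(p | d) = 1 := by
    have h2 : J(-2 | d) = 1 := by
      rw [jacobiSym.at_neg_two hdo, ZMod.χ₈'_nat_eq_if_mod_eight]
      grind
    rw [← one_mul J(p | d), ← h2, ← jacobiSym.mul_left, h2, ← jacobiSym.one_left d]
    refine jacobiSym.mod_left' (Int.modEq_iff_dvd.mpr ⟨n, ?_⟩)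
    have h' : 2 * (p : ℤ) + 1 = d * n := by exact_mod_cast h
    linarith
  rw [jacobiSym.neg _ hpo]
  rcases Nat.odd_mod_four_iff.mp hp with hp4 | hp4
  · rw [ZMod.χ₄_nat_one_mod_four hp4, one_mul,
      jacobiSym.quadratic_reciprocity_one_mod_four' hdo hp4, hpd]
  · rw [ZMod.χ₄_nat_three_mod_four hp4,
      jacobiSym.quadratic_reciprocity_three_mod_four (by omega) hp4, hpd]
    norm_num

theorem exists_prime_eq_mul_add {q e : ℕ} (hq : q ≠ 0) (h : e.Coprime q) :
    ∃ j : ℕ, (q * j + e).Prime := by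
  obtain ⟨p, hp, hprime, hmod⟩ := Nat.forall_exists_prime_gt_and_modEq e hq h
  obtain ⟨j, hj⟩ := (Nat.modEq_iff_dvd' hp.le).mp hmod.symm
  exact ⟨j, by rwa [← hj, Nat.sub_add_cancel hp.le]⟩

theorem exists_dvd_of_mod_four_eq_two {n : ℕ} (hn : n % 4 = 2) :
    ∃ (d : ℕ) (q : ℤ), 1 < d * n ∧ (d * n - 1 : ℤ) ∣ q ^ 2 + d := by
  have hco : (n - 1).Coprime (4 * n) := by
    refine Nat.Coprime.mul_right ?_ ?_
    · exact Nat.Coprime.pow_right 2 (Nat.coprime_two_right.mpr (Nat.odd_iff.mpr (by omega)))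
    · exact (Nat.coprime_self_sub_left (by omega)).mpr (by simp)
  obtain ⟨j, hj⟩ := exists_prime_eq_mul_add (by omega) hco
  set p := 4 * n * j + (n - 1) with hp
  have hpd : p + 1 = (4 * j + 1) * n := by
    have : p + 1 = 4 * n * j + n := by omega
    rw [this]; ring
  obtain ⟨x, hx⟩ := exists_dvd_sq_add_of_jacobiSym hj
    (jacobiSym_neg_of_add_one_eq hpd (by rw [hp, mul_assoc]; omega) (by omega))
  have hp0 := hj.pos
  refine ⟨4 * j + 1, x, by omega, ?_⟩
  have : ((4 * j + 1 : ℕ) * n - 1 : ℤ) = p := by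
    rw [sub_eq_iff_eq_add]; exact_mod_cast hpd.symm
  rw [this]
  exact hx

theorem exists_dvd_of_odd {n c : ℕ} (hc : c = 3 ∧ (n % 8 = 1 ∨ n % 8 = 5) ∨ c = 1 ∧ n % 8 = 3) :
    ∃ (d : ℕ) (q : ℤ), 1 < d * n ∧ (d * n - 1 : ℤ) ∣ q ^ 2 + d := by
  obtain ⟨e, he⟩ : ∃ e, c * n = 2 * e + 1 := by
    rcases hc with ⟨rfl, h⟩ | ⟨rfl, h⟩
    · exact ⟨(3 * n - 1) / 2, by omega⟩
    · exact ⟨(n - 1) / 2, by omega⟩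
  have he2 : e % 2 = 1 ∧ (c = 1 → e % 4 = 1) := by
    rcases hc with ⟨rfl, h⟩ | ⟨rfl, h⟩ <;> omega
  have hco : e.Coprime (4 * n) := by
    refine Nat.Coprime.mul_right ?_ ?_
    · exact Nat.Coprime.pow_right 2 (Nat.coprime_two_right.mpr (Nat.odd_iff.mpr he2.1))
    · have he' : (c : ℤ) * n = 2 * e + 1 := by exact_mod_cast he
      exact Nat.isCoprime_iff_coprime.mp ⟨-2, c, by linarith⟩
  obtain ⟨j, hj⟩ := exists_prime_eq_mul_add (by omega) hco
  set p := 4 * n * j + e with hp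
  have hpd : 2 * p + 1 = (8 * j + c) * n := by rw [add_mul, he, hp]; ring
  have hp2 : p % 2 = 1 := by rw [hp, mul_assoc]; omega
  obtain ⟨x, hx⟩ := exists_dvd_sq_add_of_jacobiSym hj
    (jacobiSym_neg_of_two_mul_add_one_eq hpd hp2 (by
      rcases hc with ⟨rfl, h⟩ | ⟨rfl, h⟩
      · left; omega
      · right; rw [hp, mul_assoc]; omega))
  have hd2 : Odd ((8 * j + c : ℕ) : ℤ) := by
    rw [Int.odd_coe_nat, Nat.odd_iff]; omega
  have hpo : Odd (p : ℤ) := by rwa [Int.odd_coe_nat, Nat.odd_iff]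
  obtain ⟨y, hyo, hy⟩ : ∃ y : ℤ, Odd y ∧ (p : ℤ) ∣ y ^ 2 + (8 * j + c : ℕ) := by
    rcases Int.even_or_odd x with hxe | hxo
    · refine ⟨x + p, hxe.add_odd hpo, ?_⟩
      have : (x + p) ^ 2 + (8 * j + c : ℕ) = x ^ 2 + (8 * j + c : ℕ) + p * (2 * x + p) := by ring
      rw [this]
      exact dvd_add hx (dvd_mul_right _ _)
    · exact ⟨x, hxo, hx⟩
  have hp0 := hj.pos
  refine ⟨8 * j + c, y, by omega, ?_⟩
  have : ((8 * j + c : ℕ) * n - 1 : ℤ) = 2 * p := by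
    rw [sub_eq_iff_eq_add]; exact_mod_cast hpd.symm
  rw [this]
  refine IsCoprime.mul_dvd ?_ (hyo.pow.add_odd hd2).two_dvd hy
  exact Int.isCoprime_two_left.mpr hpo

/-- The primitive form of the three squares theorem. -/
theorem exists_primitive_sum_three_squares {n : ℕ} (h0 : n % 4 ≠ 0) (h7 : n % 8 ≠ 7) :
    ∃ x y z : ℤ, Int.gcd x (Int.gcd y z) = 1 ∧ x ^ 2 + y ^ 2 + z ^ 2 = n := by
  obtain ⟨d, q, hdn, hdvd⟩ : ∃ (d : ℕ) (q : ℤ), 1 < d * n ∧ (d * n - 1 : ℤ) ∣ q ^ 2 + d := by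
    rcases (by omega : n % 4 = 2 ∨ (n % 8 = 1 ∨ n % 8 = 5) ∨ n % 8 = 3) with h | h | h
    · exact exists_dvd_of_mod_four_eq_two h
    · exact exists_dvd_of_odd (c := 3) (.inl ⟨rfl, h⟩)
    · exact exists_dvd_of_odd (c := 1) (.inr ⟨rfl, h⟩)
  exact exists_rep_of_dvd hdn hdvd

theorem stmt_11 (n : ℕ) (hn : 0 < n) :
    (∃ x y z w : ℤ, Int.gcd x (Int.gcd y (Int.gcd z w)) = 1 ∧
      x ^ 2 + y ^ 2 + z ^ 2 + 6 * w ^ 2 = (n : ℤ)) ↔ n ≠ 4 := by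
  constructor
  · rintro ⟨x, y, z, w, hg, h⟩ rfl
    push_cast at h
    obtain rfl : w = 0 := by
      by_contra hw
      have : 0 < w ^ 2 := by positivity
      nlinarith [sq_nonneg x, sq_nonneg y, sq_nonneg z]
    have hmod : x ^ 2 % 4 + y ^ 2 % 4 + z ^ 2 % 4 ≡ 0 [ZMOD 4] := by
      unfold Int.ModEq; omega
    have hsq : ∀ v : ℤ, (v % 2 = 0 ∧ v ^ 2 % 4 = 0) ∨ (v % 2 = 1 ∧ v ^ 2 % 4 = 1) := by
      intro v
      rcases Int.even_or_odd' v with ⟨k, rfl | rfl⟩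
      · left; ring_nf; omega
      · right; ring_nf; omega
    have hx := hsq x
    have hy := hsq y
    have hz := hsq z
    unfold Int.ModEq at hmod
    have h2 : ((2 : ℕ) : ℤ) ∣ Int.gcd x (Int.gcd y (Int.gcd z 0)) := by
      refine Int.dvd_coe_gcd (by omega) (Int.dvd_coe_gcd (by omega) (Int.dvd_coe_gcd ?_ ?_))
      · omega
      · simp
    rw [hg] at h2
    norm_num at h2
  · intro h4
    by_cases h : n % 4 ≠ 0 ∧ n % 8 ≠ 7
    · obtain ⟨x, y, z, hg, h⟩ := exists_primitive_sum_three_squares h.1 h.2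
      exact ⟨x, y, z, 0, by simpa [Int.gcd_def, Int.natAbs_abs] using hg, by linarith⟩
    · obtain ⟨x, y, z, -, h⟩ :=
        exists_primitive_sum_three_squares (n := n - 6) (by omega) (by omega)
      refine ⟨x, y, z, 1, by simp, ?_⟩
      rw [Nat.cast_sub (by omega)] at h
      push_cast at h
      linarith
end
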